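/- For any prescribed tolerance ε > 0, any 0 < δ < R, and any λ > 0, there exist a step size h > 0, a starting point t₀ ∈ [0, h), and integers M₁, M₂ such that for all r ∈ [δ, R], |e^{−r/λ}/r − h·∑_{m=−M₁}^{M₂} f(t₀ + mh, r)| ≤ ε, where f(t, r) = (1/√π)·exp(−r² e^t − e^{−t}/(4λ²) + t/2). -/

import Mathlib

open Real

open MeasureTheory Filter Topology in
lemma sog_core (r b : ℝ) (hr : 0 < r) (hb : 0 < b) :
    Integrable (fun t : ℝ => rexp (-(r * rexp (t/2) - b * rexp (-t/2))^2) * rexp (t/2)) ∧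
    ∫ t : ℝ, rexp (-(r * rexp (t/2) - b * rexp (-t/2))^2) * rexp (t/2) = √π / r := by
  set w : ℝ → ℝ := fun t => r * rexp (t/2) - b * rexp (-t/2) with hw
  set w' : ℝ → ℝ := fun t => r * rexp (t/2) / 2 + b * rexp (-t/2) / 2 with hw'
  have hd : ∀ t, HasDerivAt w (w' t) t := by
    intro t
    have h1 : HasDerivAt (fun t : ℝ => rexp (t/2)) (rexp (t/2) * (1/2)) t :=
      ((hasDerivAt_id t).div_const 2).exp
    have h2 : HasDerivAt (fun t : ℝ => rexp (-t/2)) (rexp (-t/2) * (-1/2)) t :=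
      ((hasDerivAt_id t).neg.div_const 2).exp
    exact ((h1.const_mul r).sub (h2.const_mul b)).congr_deriv (by simp only [hw']; ring)
  have hpos : ∀ t, 0 < w' t := fun t => by simp only [hw']; positivity
  have hmono : StrictMono w := strictMono_of_deriv_pos (fun t => by rw [(hd t).deriv]; exact hpos t)
  have hcont : Continuous w := by simp only [hw]; fun_prop
  have hcont' : Continuous w' := by simp only [hw']; fun_prop
  have htop : Tendsto w atTop atTop := by
    have h1 : Tendsto (fun t : ℝ => r * rexp (t/2)) atTop atTop :=
      (tendsto_exp_atTop.comp (tendsto_id.atTop_div_const (by norm_num : (0:ℝ) < 2))).const_mul_atTop hr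
    refine tendsto_atTop_mono' atTop ?_ (tendsto_atTop_add_const_right atTop (-b) h1)
    filter_upwards [eventually_ge_atTop 0] with t ht
    have : rexp (-t/2) ≤ 1 := exp_le_one_iff.2 (by linarith)
    simp only [hw]
    nlinarith
  have hsym : ∀ t, w (2 * Real.log (b/r) - t) = - w t ∧
      r * rexp ((2 * Real.log (b/r) - t)/2) = b * rexp (-t/2) := by
    intro t
    have e1 : rexp ((2 * Real.log (b/r) - t)/2) = b / r * rexp (-t/2) := by
      rw [show (2 * Real.log (b/r) - t)/2 = Real.log (b/r) + -t/2 by ring, Real.exp_add,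
        Real.exp_log (by positivity)]
    have e2 : rexp (-(2 * Real.log (b/r) - t)/2) = r / b * rexp (t/2) := by
      rw [show -(2 * Real.log (b/r) - t)/2 = -Real.log (b/r) + t/2 by ring, Real.exp_add, Real.exp_neg,
        Real.exp_log (by positivity), inv_div]
    simp only [hw]
    rw [e1, e2]
    constructor <;> field_simp
    ring
  have hbot : Tendsto w atBot atBot := by
    have h1 : Tendsto (fun t : ℝ => w (2 * Real.log (b/r) - t)) atBot atTop := by
      refine htop.comp ?_
      refine Tendsto.congr (fun t => (sub_eq_add_neg _ t).symm) ?_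
      exact tendsto_atTop_add_const_left atBot (2 * Real.log (b/r)) tendsto_neg_atBot_atTop
    have h2 := tendsto_neg_atTop_atBot.comp h1
    refine h2.congr fun t => ?_
    simp [(hsym t).1]
  have hsurj : Function.Surjective w := hcont.surjective htop hbot
  have himg : w '' Set.univ = Set.univ := by rw [Set.image_univ, hsurj.range_eq]
  have hint : Integrable (fun t => w' t * rexp (-(w t)^2)) := by
    have := (integrableOn_image_iff_integrableOn_abs_deriv_smul (s := Set.univ) MeasurableSet.univ
      (fun t _ => (hd t).hasDerivWithinAt) hmono.injective.injOn (fun x => rexp (-x^2))).1 (by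
        rw [himg, integrableOn_univ]
        simpa using integrable_exp_neg_mul_sq (b := 1) one_pos)
    rw [integrableOn_univ] at this
    simpa [abs_of_pos (hpos _)] using this
  have hval : ∫ t, w' t * rexp (-(w t)^2) = √π := by
    have := (integral_image_eq_integral_abs_deriv_smul (s := Set.univ) MeasurableSet.univ
      (fun t _ => (hd t).hasDerivWithinAt) hmono.injective.injOn (fun x => rexp (-x^2)))
    rw [himg, setIntegral_univ, setIntegral_univ] at this
    have g := integral_gaussian 1
    simp only [neg_mul, one_mul, div_one] at g
    rw [g] at this
    simpa [abs_of_pos (hpos _)] using this.symm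
  have hI : Integrable (fun t : ℝ => rexp (-(w t)^2) * rexp (t/2)) := by
    refine (hint.const_mul (2/r)).mono' (by fun_prop) (ae_of_all _ fun t => ?_)
    rw [Real.norm_of_nonneg (by positivity)]
    have : 2 / r * (w' t * rexp (-(w t)^2)) =
      rexp (-(w t)^2) * rexp (t/2) + b / r * rexp (-t/2) * rexp (-(w t)^2) := by
      simp only [hw']; field_simp
    rw [this]
    have : 0 ≤ b / r * rexp (-t/2) * rexp (-(w t)^2) := by positivity
    linarith
  refine ⟨hI, ?_⟩
  have hB : ∫ t, rexp (-(w t)^2) * (b * rexp (-t/2)) = ∫ t, rexp (-(w t)^2) * (r * rexp (t/2)) := by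
    rw [← integral_sub_left_eq_self (fun t => rexp (-(w t)^2) * (r * rexp (t/2))) volume (2 * Real.log (b/r))]
    congr 1; ext t
    rw [(hsym t).1, (hsym t).2, neg_sq]
  have hA : ∫ t, rexp (-(w t)^2) * (r * rexp (t/2)) = r * ∫ t, rexp (-(w t)^2) * rexp (t/2) := by
    rw [← integral_const_mul]; congr 1; ext t; ring
  have hIB : ∫ t, rexp (-(w t)^2) * (b * rexp (-t/2)) =
      2 * √π - r * ∫ t, rexp (-(w t)^2) * rexp (t/2) := by
    rw [← hval, ← integral_const_mul, ← integral_const_mul, ← integral_sub (hint.const_mul 2) (hI.const_mul r)]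
    congr 1; ext t; simp only [hw']; ring
  rw [hB, hA] at hIB
  rw [eq_div_iff hr.ne']
  linarith

noncomputable def sogF (lam r t : ℝ) : ℝ :=
  (1 / Real.sqrt π) * Real.exp (-(r ^ 2 * Real.exp t) - Real.exp (-t) / (4 * lam ^ 2) + t / 2)

open MeasureTheory in
lemma sogF_int (lam r : ℝ) (hr : 0 < r) (hlam : 0 < lam) :
    Integrable (sogF lam r) ∧ ∫ t, sogF lam r t = rexp (-r / lam) / r := by
  obtain ⟨h1, h2⟩ := sog_core r (1/(2*lam)) hr (by positivity)
  have key : sogF lam r = fun t => (1 / √π * rexp (-r/lam)) *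
      (rexp (-(r * rexp (t/2) - 1/(2*lam) * rexp (-t/2))^2) * rexp (t/2)) := by
    ext t
    unfold sogF
    rw [mul_assoc, ← Real.exp_add, ← Real.exp_add]
    congr 2
    have a1 : rexp t = rexp (t/2)^2 := by rw [← Real.exp_nat_mul]; congr 1; push_cast; ring
    have a2 : rexp (-t) = rexp (-t/2)^2 := by rw [← Real.exp_nat_mul]; congr 1; push_cast; ring
    have a3 : rexp (t/2) * rexp (-t/2) = 1 := by rw [← Real.exp_add]; simp; ring
    rw [a1, a2]
    have : (r * rexp (t/2) - 1/(2*lam) * rexp (-t/2))^2 = r^2 * rexp (t/2)^2 +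
      rexp (-t/2)^2/(4*lam^2) - r/lam * (rexp (t/2) * rexp (-t/2)) := by
      field_simp; ring
    rw [this, a3]; ring
  rw [key]
  refine ⟨h1.const_mul _, ?_⟩
  rw [integral_const_mul, h2]
  have : √π ≠ 0 := by positivity
  field_simp

open MeasureTheory in
/-- left Riemann sum error -/
lemma sog_riemann (f : ℝ → ℝ) (hf : Continuous f) (N : ℕ) (h η : ℝ) (hh : 0 < h)
    (H : ∀ x ∈ Set.Icc (-(N*h)) (N*h), ∀ y ∈ Set.Icc (-(N*h)) (N*h), |x - y| ≤ h → |f x - f y| ≤ η) :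
    |(∫ t in (-(N*h))..(N*h), f t) - h * ∑ m ∈ Finset.Icc (-(N:ℤ)) ((N:ℤ)-1), f ((m:ℝ)*h)| ≤
      2 * (N*h) * η := by
  have hs : ∑ m ∈ Finset.Icc (-(N:ℤ)) ((N:ℤ)-1), f ((m:ℝ)*h) =
      ∑ k ∈ Finset.range (2*N), f (((k:ℝ)-N)*h) := by
    refine Finset.sum_nbij' (fun m => (m+N).toNat) (fun k => (k:ℤ)-N) ?_ ?_ ?_ ?_ ?_
    · intro m hm; simp at hm ⊢; omega
    · intro m hm; simp at hm ⊢; omega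
    · intro m hm; simp at hm ⊢; omega
    · intro m hm; simp
    · intro m hm
      simp at hm
      have : (((m+N).toNat : ℤ) : ℝ) = m + N := by
        rw [Int.toNat_of_nonneg (by omega)]; push_cast; rfl
      rw [Int.cast_natCast] at this
      rw [this]; congr 1; ring
  have hi := intervalIntegral.sum_integral_adjacent_intervals (μ := volume) (f := f)
    (a := fun k : ℕ => ((k:ℝ)-N)*h) (n := 2*N) (fun k _ => hf.intervalIntegrable _ _)
  have e0 : (((0:ℕ):ℝ)-N)*h = -(N*h) := by push_cast; ring
  have e1 : (((2*N:ℕ):ℝ)-N)*h = N*h := by push_cast; ring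
  rw [e0, e1] at hi
  rw [hs, ← hi, Finset.mul_sum, ← Finset.sum_sub_distrib]
  refine (Finset.abs_sum_le_sum_abs _ _).trans ?_
  have : ∀ k ∈ Finset.range (2*N),
      |(∫ t in (((k:ℝ)-N)*h)..((((k+1:ℕ):ℝ)-N)*h), f t) - h * f (((k:ℝ)-N)*h)| ≤ h * η := by
    intro k hk
    have hk' : ((k+1:ℕ):ℝ) ≤ 2*N := by exact_mod_cast Finset.mem_range.1 hk
    push_cast at hk'
    have hk0 : (0:ℝ) ≤ k := Nat.cast_nonneg k
    set a := ((k:ℝ)-N)*h with ha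
    have hb : (((k+1:ℕ):ℝ)-N)*h = a + h := by rw [ha]; push_cast; ring
    have l1 : -(N*h) ≤ a := by rw [ha]; nlinarith
    have l2 : a + h ≤ N*h := by rw [ha]; nlinarith
    rw [hb]
    have : h * f a = ∫ t in a..(a+h), f a := by simp
    rw [this, ← intervalIntegral.integral_sub (hf.intervalIntegrable _ _) (by simp)]
    have := intervalIntegral.norm_integral_le_of_norm_le_const (a := a) (b := a+h) (C := η)
      (f := fun t => f t - f a) (by
        intro x hx
        rw [Set.uIoc_of_le (by linarith)] at hx
        refine H x ⟨by linarith [hx.1], by linarith [hx.2]⟩ a ⟨l1, by linarith⟩ ?_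
        rw [abs_of_nonneg (by linarith [hx.1])]; linarith [hx.2])
    rw [Real.norm_eq_abs] at this
    simpa [abs_of_pos hh, mul_comm] using this
  refine (Finset.sum_le_sum this).trans ?_
  simp; apply le_of_eq; ring

lemma sogF_nonneg (lam r t : ℝ) : 0 ≤ sogF lam r t := by unfold sogF; positivity

lemma sogF_mono (lam δ r t : ℝ) (hδ : 0 < δ) (h : δ ≤ r) : sogF lam r t ≤ sogF lam δ t := by
  unfold sogF; gcongr

lemma sogF_cont (lam : ℝ) : Continuous (fun p : ℝ × ℝ => sogF lam p.1 p.2) := by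
  unfold sogF; fun_prop

open MeasureTheory Filter Topology in
lemma sog_aux (ε δ R lam : ℝ) (hε : 0 < ε) (hδ : 0 < δ) (hlam : 0 < lam) :
    ∃ h : ℝ, 0 < h ∧ ∃ N : ℕ, ∀ r ∈ Set.Icc δ R,
      |rexp (-r / lam) / r - h * ∑ m ∈ Finset.Icc (-(N:ℤ)) ((N:ℤ)-1), sogF lam r ((m:ℝ)*h)| ≤ ε := by
  obtain ⟨I0, -⟩ := sogF_int lam δ hδ hlam
  have ht := intervalIntegral_tendsto_integral I0 tendsto_neg_atTop_atBot tendsto_id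
  obtain ⟨T, hT1, hT0⟩ := ((ht.eventually (lt_mem_nhds (sub_lt_self _ (half_pos hε)))).and
    (eventually_gt_atTop 0)).exists
  simp only [id] at hT1
  have tail : ∀ r ∈ Set.Icc δ R,
      |rexp (-r / lam) / r - ∫ t in (-T)..T, sogF lam r t| ≤ ε/2 := by
    intro r hr
    obtain ⟨I1, v⟩ := sogF_int lam r (hδ.trans_le hr.1) hlam
    rw [← v]
    have split : ∀ g : ℝ → ℝ, Integrable g →
        ∫ t, g t = (∫ t in (-T)..T, g t) + ∫ t in (Set.Ioc (-T) T)ᶜ, g t := by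
      intro g hg
      rw [intervalIntegral.integral_of_le (by linarith), integral_add_compl measurableSet_Ioc hg]
    rw [split _ I0] at hT1
    rw [split _ I1, add_sub_cancel_left, abs_of_nonneg (integral_nonneg fun t => sogF_nonneg _ _ _)]
    have := integral_mono I1.integrableOn.integrable I0.integrableOn.integrable
      (μ := volume.restrict (Set.Ioc (-T) T)ᶜ) (fun t => sogF_mono lam δ r t hδ hr.1)
    linarith
  have hK : IsCompact (Set.Icc δ R ×ˢ Set.Icc (-T) T) := isCompact_Icc.prod isCompact_Icc
  have huc := hK.uniformContinuousOn_of_continuous (sogF_cont lam).continuousOn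
  rw [Metric.uniformContinuousOn_iff] at huc
  obtain ⟨d, hd, H⟩ := huc (ε/(4*T)) (by positivity)
  obtain ⟨n, hn⟩ := exists_nat_gt (T/d)
  have hn0 : (0:ℝ) < n := lt_trans (by positivity) hn
  have hNh : (n:ℝ) * (T/n) = T := by field_simp
  refine ⟨T/n, by positivity, n, fun r hr => ?_⟩
  have hR := sog_riemann (sogF lam r)
    ((sogF_cont lam).comp (by fun_prop : Continuous fun t : ℝ => (r, t))) n (T/n) (ε/(4*T))
    (by positivity) (by
      rw [hNh]
      intro x hx y hy hxy
      have := H (r,x) ⟨hr, hx⟩ (r,y) ⟨hr, hy⟩ (by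
        rw [Prod.dist_eq]
        simp only [dist_self, Real.dist_eq]
        rw [max_eq_right (abs_nonneg _)]
        refine hxy.trans_lt ?_
        rw [div_lt_iff₀ hd] at hn
        rw [div_lt_iff₀ hn0]; linarith)
      rw [Real.dist_eq] at this
      exact this.le)
  rw [hNh] at hR
  have e : 2 * T * (ε/(4*T)) = ε/2 := by field_simp; norm_num
  rw [e] at hR
  refine (abs_sub_le _ (∫ t in (-T)..T, sogF lam r t) _).trans ?_
  linarith [tail r hr]

/-- Main SOG approximation theorem for the Yukawa kernel: for any tolerance `ε > 0`, any
`0 < δ < R` and any `λ > 0`, there exist a step size `h > 0`, a starting point `t₀ ∈ [0,h)`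
and integers `M₁, M₂` such that, with `f(t,r) = (1/√π)·exp(−r² e^t − e^{−t}/(4λ²) + t/2)`,
`|e^{−r/λ}/r − h ∑_{m=−M₁}^{M₂} f(t₀+mh, r)| ≤ ε` for all `r ∈ [δ, R]`. -/
theorem sog_approximation (ε δ R lam : ℝ) (hε : 0 < ε) (hδ : 0 < δ) (hδR : δ < R)
    (hlam : 0 < lam) :
    ∃ h : ℝ, 0 < h ∧ ∃ t₀ ∈ Set.Ico (0 : ℝ) h, ∃ M₁ M₂ : ℤ,
      ∀ r ∈ Set.Icc δ R,
        |Real.exp (-r / lam) / r -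
            h * ∑ m ∈ Finset.Icc (-M₁) M₂,
              (1 / Real.sqrt π) *
                Real.exp (-(r ^ 2 * Real.exp (t₀ + (m : ℝ) * h)) -
                  Real.exp (-(t₀ + (m : ℝ) * h)) / (4 * lam ^ 2) + (t₀ + (m : ℝ) * h) / 2)| ≤
          ε := by
  obtain ⟨h, hh, N, H⟩ := sog_aux ε δ R lam hε hδ hlam
  refine ⟨h, hh, 0, ⟨le_rfl, hh⟩, N, N - 1, fun r hr => ?_⟩
  simpa only [zero_add, sogF] using H r hr
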